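/- Let H ∈ (1/2, 1) and K(t,s) = c_H · s^{1/2-H} · ∫_s^t (u-s)^{H-3/2} u^{H-1/2} du for 0 < s < t. Then for all 0 < α < r < t, one has K(t, r-α) ≤ (r/(r-α))^{H-1/2} · K(t+α, r). -/

import Mathlib

open MeasureTheory Set

/-- For the Volterra kernel `K(t,s) = c_H s^{1/2-H} ∫_s^t (u-s)^{H-3/2} u^{H-1/2} du`
with `H ∈ (1/2,1)`, for all `0 < α < r < t` one has
`K(t, r-α) ≤ (r/(r-α))^{H-1/2} K(t+α, r)`. -/
theorem volterra_kernel_shift_lower (H cH : ℝ) (hH : H ∈ Set.Ioo (1/2 : ℝ) 1) (hc : 0 < cH)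
    (K : ℝ → ℝ → ℝ)
    (hK : ∀ t s : ℝ, 0 < s → s < t →
      K t s = cH * s ^ (1/2 - H) * ∫ u in s..t, (u - s) ^ (H - 3/2) * u ^ (H - 1/2)) :
    ∀ t r α : ℝ, 0 < α → α < r → r < t →
      K t (r - α) ≤ (r / (r - α)) ^ (H - 1/2) * K (t + α) r := by
  intro t r α hα hr ht
  obtain ⟨h1, h2⟩ := hH
  have hra : 0 < r - α := by linarith
  have hr0 : 0 < r := by linarith
  rw [hK t (r - α) hra (by linarith), hK (t + α) r hr0 (by linarith)]
  have hcoef : (r / (r - α)) ^ (H - 1/2) * r ^ (1/2 - H) = (r - α) ^ (1/2 - H) := by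
    rw [Real.div_rpow hr0.le hra.le, show (1/2 - H) = -(H - 1/2) by ring,
      Real.rpow_neg hr0.le, Real.rpow_neg hra.le]
    have := (Real.rpow_pos_of_pos hr0 (H - 1/2)).ne'
    have := (Real.rpow_pos_of_pos hra (H - 1/2)).ne'
    field_simp
  have hint : ∀ β : ℝ, IntervalIntegrable
      (fun v => (v - r) ^ (H - 3/2) * (v - β) ^ (H - 1/2)) volume r (t + α) := by
    intro β
    have h0 : IntervalIntegrable (fun x : ℝ => x ^ (H - 3/2)) volume (r - r) (t + α - r) :=
      intervalIntegral.intervalIntegrable_rpow' (by linarith)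
    have h3 := h0.comp_sub_right r
    simp only [sub_add_cancel] at h3
    refine h3.mul_continuousOn (Continuous.continuousOn ?_)
    exact (continuous_id.sub continuous_const).rpow_const (fun x => Or.inr (by linarith))
  have hshift : (∫ u in (r - α)..t, (u - (r - α)) ^ (H - 3/2) * u ^ (H - 1/2))
      = ∫ v in r..(t + α), (v - r) ^ (H - 3/2) * (v - α) ^ (H - 1/2) := by
    have := intervalIntegral.integral_comp_sub_right (a := r) (b := t + α)
      (fun u => (u - (r - α)) ^ (H - 3/2) * u ^ (H - 1/2)) α
    rw [add_sub_cancel_right] at this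
    rw [← this]
    congr 1
    ext v
    congr 2
    ring
  have hle : (∫ v in r..(t + α), (v - r) ^ (H - 3/2) * (v - α) ^ (H - 1/2))
      ≤ ∫ v in r..(t + α), (v - r) ^ (H - 3/2) * v ^ (H - 1/2) := by
    refine intervalIntegral.integral_mono_on (by linarith) (hint α) (by simpa using hint 0) ?_
    intro v hv
    have := hv.1
    exact mul_le_mul_of_nonneg_left
      (Real.rpow_le_rpow (by linarith) (by linarith) (by linarith))
      (Real.rpow_nonneg (by linarith) _)
  rw [hshift]
  calc _ ≤ cH * (r - α) ^ (1/2 - H) *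
        ∫ v in r..(t + α), (v - r) ^ (H - 3/2) * v ^ (H - 1/2) :=
        mul_le_mul_of_nonneg_left hle (mul_nonneg hc.le (Real.rpow_nonneg hra.le _))
    _ = _ := by rw [← hcoef]; ring
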